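/- Let F be a field of characteristic 0 and let q1, q2 be quadratic forms on F^4. Define quadratic forms Q1 and Q2 on F^10 (coordinates x1,…,x10) by Q1 = q1(x1,x2,x3,x4) + x5·x6 + x8·x9 and Q2 = q2(x1,x2,x3,x4) + x5·x7 + x8·x10. Then there exists a 5-dimensional F-linear subspace of F^10 on which both Q1 and Q2 vanish identically if and only if there exists a nonzero vector v ∈ F^4 with q1(v) = 0 and q2(v) = 0. -/

import Mathlib

/-- Given a quadratic form `q1` on `F^4`, the quadratic form
`Q1(x1,…,x10) = q1(x1,x2,x3,x4) + x5·x6 + x8·x9` on `F^10` (indices are 0-based below). -/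
noncomputable def amerFormFst10 {F : Type*} [Field F] (q1 : QuadraticForm F (Fin 4 → F)) :
    QuadraticForm F (Fin 10 → F) :=
  q1.comp (LinearMap.funLeft F F (Fin.castLE (by omega))) +
    QuadraticMap.proj (R := F) (A := F) (4 : Fin 10) 5 +
    QuadraticMap.proj (R := F) (A := F) (7 : Fin 10) 8

/-- Given a quadratic form `q2` on `F^4`, the quadratic form
`Q2(x1,…,x10) = q2(x1,x2,x3,x4) + x5·x7 + x8·x10` on `F^10` (indices are 0-based below). -/
noncomputable def amerFormSnd10 {F : Type*} [Field F] (q2 : QuadraticForm F (Fin 4 → F)) :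
    QuadraticForm F (Fin 10 → F) :=
  q2.comp (LinearMap.funLeft F F (Fin.castLE (by omega))) +
    QuadraticMap.proj (R := F) (A := F) (4 : Fin 10) 6 +
    QuadraticMap.proj (R := F) (A := F) (7 : Fin 10) 9

theorem amerFst_apply {F : Type*} [Field F] (q : QuadraticForm F (Fin 4 → F))
    (x : Fin 10 → F) :
    amerFormFst10 q x = q ![x 0, x 1, x 2, x 3] + x 4 * x 5 + x 7 * x 8 := by
  have h : (LinearMap.funLeft F F (Fin.castLE (by omega : 4 ≤ 10))) x
      = ![x 0, x 1, x 2, x 3] := by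
    funext i; fin_cases i <;> rfl
  simp [amerFormFst10, h]

theorem amerSnd_apply {F : Type*} [Field F] (q : QuadraticForm F (Fin 4 → F))
    (x : Fin 10 → F) :
    amerFormSnd10 q x = q ![x 0, x 1, x 2, x 3] + x 4 * x 6 + x 7 * x 9 := by
  have h : (LinearMap.funLeft F F (Fin.castLE (by omega : 4 ≤ 10))) x
      = ![x 0, x 1, x 2, x 3] := by
    funext i; fin_cases i <;> rfl
  simp [amerFormSnd10, h]

/-- A 5-dimensional subspace has a nonzero vector with four prescribed vanishing coordinates. -/
theorem exists_vanishing {F : Type*} [Field F] (W : Submodule F (Fin 10 → F))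
    (hW : Module.finrank F W = 5) (s : Fin 4 → Fin 10) :
    ∃ u ∈ W, u ≠ 0 ∧ ∀ i, u (s i) = 0 := by
  have h : LinearMap.ker ((LinearMap.funLeft F F s).comp W.subtype) ≠ ⊥ :=
    LinearMap.ker_ne_bot_of_finrank_lt (by rw [hW]; simp)
  obtain ⟨u, hu, hu0⟩ := Submodule.exists_mem_ne_zero_of_ne_bot h
  refine ⟨u, u.2, fun hh => hu0 (Subtype.ext hh), fun i => ?_⟩
  exact congrFun (LinearMap.mem_ker.mp hu) i

/-- If `u ∈ W` has no components outside the coordinates 6, 7, 9, 10, it is orthogonal to `W`. -/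
theorem orth_of_mem {F : Type*} [Field F] (q1 q2 : QuadraticForm F (Fin 4 → F))
    (W : Submodule F (Fin 10 → F))
    (h : ∀ x ∈ W, amerFormFst10 q1 x = 0 ∧ amerFormSnd10 q2 x = 0)
    (u w : Fin 10 → F) (hu : u ∈ W) (hw : w ∈ W)
    (h0 : ![u 0, u 1, u 2, u 3] = 0) (h4 : u 4 = 0) (h7 : u 7 = 0) :
    w 4 * u 5 + w 7 * u 8 = 0 ∧ w 4 * u 6 + w 7 * u 9 = 0 := by
  have a := h w hw
  have b := h _ (W.add_mem hw hu)
  have e0 : u 0 = 0 := congrFun h0 0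
  have e1 : u 1 = 0 := congrFun h0 1
  have e2 : u 2 = 0 := congrFun h0 2
  have e3 : u 3 = 0 := congrFun h0 3
  simp only [amerFst_apply, amerSnd_apply, Pi.add_apply, e0, e1, e2, e3, h4, h7, add_zero] at a b
  constructor
  · linear_combination b.1 - a.1
  · linear_combination b.2 - a.2

theorem eq_zero_ten {F : Type*} [Field F] (u : Fin 10 → F)
    (h0 : ![u 0, u 1, u 2, u 3] = 0) (h4 : u 4 = 0) (h5 : u 5 = 0) (h6 : u 6 = 0)
    (h7 : u 7 = 0) (h8 : u 8 = 0) (h9 : u 9 = 0) : u = 0 := by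
  have e0 : u 0 = 0 := congrFun h0 0
  have e1 : u 1 = 0 := congrFun h0 1
  have e2 : u 2 = 0 := congrFun h0 2
  have e3 : u 3 = 0 := congrFun h0 3
  funext i
  fin_cases i <;> assumption

/-- The parametrisation of the subspace spanned by `v` and four coordinate vectors. -/
def paramFive {F : Type*} [Field F] (v : Fin 4 → F) : (Fin 5 → F) →ₗ[F] (Fin 10 → F) where
  toFun c := ![c 0 * v 0, c 0 * v 1, c 0 * v 2, c 0 * v 3, 0, c 1, c 2, 0, c 3, c 4]
  map_add' a b := by
    funext i; fin_cases i <;> simp [add_mul]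
  map_smul' a b := by
    funext i; fin_cases i <;> simp [mul_assoc]

/-- Let `F` be a field of characteristic `0` and `q1`, `q2` quadratic forms on `F^4`. The
forms `Q1 = q1(x1,…,x4) + x5 x6 + x8 x9` and `Q2 = q2(x1,…,x4) + x5 x7 + x8 x10` on `F^10`
vanish identically on a common `5`-dimensional linear subspace of `F^10` iff `q1` and `q2`
have a common nontrivial zero in `F^4`. -/
theorem amer_subspace_ten_iff_common_zero (F : Type*) [Field F] [CharZero F]
    (q1 q2 : QuadraticForm F (Fin 4 → F)) :
    (∃ W : Submodule F (Fin 10 → F), Module.finrank F ↥W = 5 ∧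
        ∀ x ∈ W, amerFormFst10 q1 x = 0 ∧ amerFormSnd10 q2 x = 0) ↔
      ∃ v : Fin 4 → F, v ≠ 0 ∧ q1 v = 0 ∧ q2 v = 0 := by
  constructor
  · rintro ⟨W, hW, h⟩
    have key : ∀ u ∈ W, u 4 = 0 → u 7 = 0 → ![u 0, u 1, u 2, u 3] ≠ 0 →
        ∃ v : Fin 4 → F, v ≠ 0 ∧ q1 v = 0 ∧ q2 v = 0 := by
      intro u hu h4 h7 hne
      have a := h u hu
      simp only [amerFst_apply, amerSnd_apply, h4, h7, zero_mul, add_zero] at a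
      exact ⟨_, hne, a⟩
    by_cases c4 : ∃ w ∈ W, w 4 ≠ 0
    · obtain ⟨w, hw, hw4⟩ := c4
      obtain ⟨u, hu, hu0, hs⟩ := exists_vanishing W hW ![4, 7, 8, 9]
      have h4 : u 4 = 0 := hs 0
      have h7 : u 7 = 0 := hs 1
      have h8 : u 8 = 0 := hs 2
      have h9 : u 9 = 0 := hs 3
      refine key u hu h4 h7 fun h0 => hu0 ?_
      have o := orth_of_mem q1 q2 W h u w hu hw h0 h4 h7
      simp [h8, h9, hw4] at o
      exact eq_zero_ten u h0 h4 o.1 o.2 h7 h8 h9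
    by_cases c7 : ∃ w ∈ W, w 7 ≠ 0
    · obtain ⟨w, hw, hw7⟩ := c7
      obtain ⟨u, hu, hu0, hs⟩ := exists_vanishing W hW ![4, 7, 5, 6]
      have h4 : u 4 = 0 := hs 0
      have h7 : u 7 = 0 := hs 1
      have h5 : u 5 = 0 := hs 2
      have h6 : u 6 = 0 := hs 3
      refine key u hu h4 h7 fun h0 => hu0 ?_
      have o := orth_of_mem q1 q2 W h u w hu hw h0 h4 h7
      simp [h5, h6, hw7] at o
      exact eq_zero_ten u h0 h4 h5 h6 h7 o.1 o.2
    · push Not at c4 c7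
      obtain ⟨u, hu, hu0, hs⟩ := exists_vanishing W hW ![5, 6, 8, 9]
      exact key u hu (c4 u hu) (c7 u hu) fun h0 => hu0
        (eq_zero_ten u h0 (c4 u hu) (hs 0) (hs 1) (c7 u hu) (hs 2) (hs 3))
  · rintro ⟨v, hv, hq1, hq2⟩
    refine ⟨LinearMap.range (paramFive v), ?_, ?_⟩
    · rw [LinearMap.finrank_range_of_inj]
      · simp
      · rw [injective_iff_map_eq_zero]
        intro c hc
        obtain ⟨j, hj⟩ := Function.ne_iff.mp hv
        have e0 : c 0 * v 0 = 0 := congrFun hc 0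
        have e1 : c 0 * v 1 = 0 := congrFun hc 1
        have e2 : c 0 * v 2 = 0 := congrFun hc 2
        have e3 : c 0 * v 3 = 0 := congrFun hc 3
        have f1 : c 1 = 0 := congrFun hc 5
        have f2 : c 2 = 0 := congrFun hc 6
        have f3 : c 3 = 0 := congrFun hc 8
        have f4 : c 4 = 0 := congrFun hc 9
        have ej : c 0 * v j = 0 := by fin_cases j <;> assumption
        have f0 : c 0 = 0 := (mul_eq_zero.mp ej).resolve_right hj
        funext i
        fin_cases i <;> assumption
    · rintro _ ⟨c, rfl⟩
      have e : ![paramFive v c 0, paramFive v c 1, paramFive v c 2, paramFive v c 3]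
          = c 0 • v := by
        funext i; fin_cases i <;> rfl
      have e4 : paramFive v c 4 = 0 := rfl
      have e7 : paramFive v c 7 = 0 := rfl
      rw [amerFst_apply, amerSnd_apply, e, e4, e7]
      simp [QuadraticMap.map_smul, hq1, hq2]
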